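/- Let k ∈ ℝ and let x, y ∈ ℝ³ with x ≠ y. Then the mixed second partial derivatives of G_k satisfy: (i) Σ_{i=1}^{3} ∂²G_k(x,y)/∂x_i∂y_i = k² G_k(x,y), and (ii) for all indices i, j, ∂²G_k(x,y)/∂x_i∂y_j = −∂²G_k(x,y)/∂x_i∂x_j, i.e. the mixed x–y Hessian equals the negative of the Hessian in x. -/

import Mathlib

/-- The Helmholtz free-space Green's function
`G_k(x,y) = e^{i k ‖x − y‖} / (4π ‖x − y‖)`. -/
noncomputable def Gk (k : ℝ) (x y : EuclideanSpace ℝ (Fin 3)) : ℂ :=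
  Complex.exp (Complex.I * k * ‖x - y‖) / (4 * Real.pi * ‖x - y‖)

/-- The derivative of a radial function away from the origin. -/
lemma hasFDerivAt_comp_norm {E F : Type*} [NormedAddCommGroup E] [InnerProductSpace ℝ E]
    [NormedAddCommGroup F] [NormedSpace ℝ F] {f : ℝ → F} {f' : F} {z : E} (hz : z ≠ 0)
    (hf : HasDerivAt f f' ‖z‖) :
    HasFDerivAt (fun w => f ‖w‖) ((‖z‖⁻¹ • innerSL ℝ z).smulRight f') z := by
  have hn : HasFDerivAt (fun w : E => ‖w‖) (‖z‖⁻¹ • innerSL ℝ z) z := by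
    have h := ((hasStrictFDerivAt_norm_sq z).hasFDerivAt).sqrt (by simpa using hz)
    simp only [Real.sqrt_sq (norm_nonneg _)] at h
    convert h using 1
    ext v
    simp
    field_simp
  have h := hf.hasFDerivAt.comp z hn
  refine h.congr_fderiv ?_
  ext v
  simp [mul_smul]

/-- The radial profile `e^{ikr} / (4πr)` of the Helmholtz Green's function. -/
noncomputable def helmholtzProfile (k r : ℝ) : ℂ :=
  Complex.exp (Complex.I * k * r) / (4 * Real.pi * r)

/-- The derivative of `helmholtzProfile k` divided by the radius. -/
noncomputable def helmholtzSlope (k r : ℝ) : ℂ :=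
  Complex.exp (Complex.I * k * r) * (Complex.I * k * r - 1) / (4 * Real.pi * r ^ 3)

lemma hasDerivAt_cexp_I_mul (k r : ℝ) :
    HasDerivAt (fun s : ℝ => Complex.exp (Complex.I * k * s))
      (Complex.exp (Complex.I * k * r) * (Complex.I * k)) r := by
  simpa using ((Complex.ofRealCLM.hasDerivAt (x := r)).const_mul (Complex.I * k)).cexp

lemma hasDerivAt_helmholtzProfile (k : ℝ) {r : ℝ} (hr : r ≠ 0) :
    HasDerivAt (helmholtzProfile k) (r * helmholtzSlope k r) r := by
  have hr' : (r : ℂ) ≠ 0 := by exact_mod_cast hr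
  have hpi : (Real.pi : ℂ) ≠ 0 := by exact_mod_cast Real.pi_ne_zero
  have hid : HasDerivAt (fun s : ℝ => (s : ℂ)) 1 r := Complex.ofRealCLM.hasDerivAt
  have h := (hasDerivAt_cexp_I_mul k r).fun_div (hid.const_mul (4 * Real.pi : ℂ))
    (by simp [hr, Real.pi_ne_zero])
  refine h.congr_deriv ?_
  unfold helmholtzSlope
  field_simp

lemma hasDerivAt_helmholtzSlope (k : ℝ) {r : ℝ} (hr : r ≠ 0) :
    HasDerivAt (helmholtzSlope k)
      (-(k ^ 2 * helmholtzProfile k r + 3 * helmholtzSlope k r) / r) r := by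
  have hr' : (r : ℂ) ≠ 0 := by exact_mod_cast hr
  have hpi : (Real.pi : ℂ) ≠ 0 := by exact_mod_cast Real.pi_ne_zero
  have hid : HasDerivAt (fun s : ℝ => (s : ℂ)) 1 r := Complex.ofRealCLM.hasDerivAt
  have h := ((hasDerivAt_cexp_I_mul k r).fun_mul
    ((hid.const_mul (Complex.I * k)).sub_const 1)).fun_div
    ((hid.fun_pow 3).const_mul (4 * Real.pi : ℂ)) (by simp [hr, Real.pi_ne_zero])
  refine h.congr_deriv ?_
  unfold helmholtzSlope helmholtzProfile
  field_simp
  ring_nf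
  simp only [Complex.I_sq]
  ring

lemma fderiv_helmholtzProfile_norm (k : ℝ) {z : EuclideanSpace ℝ (Fin 3)} (hz : z ≠ 0)
    (i : Fin 3) :
    fderiv ℝ (fun w : EuclideanSpace ℝ (Fin 3) => helmholtzProfile k ‖w‖) z
      (EuclideanSpace.single i 1) = z i * helmholtzSlope k ‖z‖ := by
  have hn : (‖z‖ : ℂ) ≠ 0 := by exact_mod_cast norm_ne_zero_iff.mpr hz
  rw [(hasFDerivAt_comp_norm hz
    (hasDerivAt_helmholtzProfile k (norm_ne_zero_iff.mpr hz))).fderiv]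
  simp [EuclideanSpace.inner_single_right]
  field_simp

lemma fderiv_fderiv_helmholtzProfile_norm (k : ℝ) {z : EuclideanSpace ℝ (Fin 3)} (hz : z ≠ 0)
    (i : Fin 3) :
    fderiv ℝ (fun u => fderiv ℝ
        (fun w : EuclideanSpace ℝ (Fin 3) => helmholtzProfile k ‖w‖) u
        (EuclideanSpace.single i 1)) z (EuclideanSpace.single i 1) =
      helmholtzSlope k ‖z‖ - (z i : ℂ) ^ 2 *
        ((k ^ 2 * helmholtzProfile k ‖z‖ + 3 * helmholtzSlope k ‖z‖) / ‖z‖ ^ 2) := by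
  have hn : (‖z‖ : ℂ) ≠ 0 := by exact_mod_cast norm_ne_zero_iff.mpr hz
  have heq : (fun u => fderiv ℝ
      (fun w : EuclideanSpace ℝ (Fin 3) => helmholtzProfile k ‖w‖) u
      (EuclideanSpace.single i 1)) =ᶠ[nhds z] fun u => (u i : ℂ) * helmholtzSlope k ‖u‖ := by
    filter_upwards [isOpen_ne.mem_nhds hz] with u hu
    exact fderiv_helmholtzProfile_norm k hu i
  have hc : HasFDerivAt (fun u : EuclideanSpace ℝ (Fin 3) => (u i : ℂ))
      (Complex.ofRealCLM.comp (EuclideanSpace.proj i)) z :=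
    (Complex.ofRealCLM.comp (EuclideanSpace.proj (𝕜 := ℝ) i)).hasFDerivAt
  rw [heq.fderiv_eq, (hc.fun_mul (hasFDerivAt_comp_norm hz
    (hasDerivAt_helmholtzSlope k (norm_ne_zero_iff.mpr hz)))).fderiv]
  simp [EuclideanSpace.inner_single_right]
  field_simp
  ring

/-- The Helmholtz equation `Δg = -k² g` away from the origin. -/
lemma sum_fderiv_fderiv_helmholtzProfile_norm (k : ℝ) {z : EuclideanSpace ℝ (Fin 3)}
    (hz : z ≠ 0) :
    ∑ i : Fin 3, fderiv ℝ (fun u => fderiv ℝ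
        (fun w : EuclideanSpace ℝ (Fin 3) => helmholtzProfile k ‖w‖) u
        (EuclideanSpace.single i 1)) z (EuclideanSpace.single i 1) =
      -(k ^ 2 * helmholtzProfile k ‖z‖) := by
  have hn : (‖z‖ : ℂ) ≠ 0 := by exact_mod_cast norm_ne_zero_iff.mpr hz
  have hsum : ∑ i : Fin 3, (z i : ℂ) ^ 2 = (‖z‖ : ℂ) ^ 2 := by
    exact_mod_cast (EuclideanSpace.real_norm_sq_eq z).symm
  simp only [fderiv_fderiv_helmholtzProfile_norm k hz, Finset.sum_sub_distrib,
    ← Finset.sum_mul, hsum]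
  simp
  field_simp
  ring

lemma fderiv_Gk_left (k : ℝ) (w y : EuclideanSpace ℝ (Fin 3)) :
    fderiv ℝ (fun v => Gk k v y) w =
      fderiv ℝ (fun v : EuclideanSpace ℝ (Fin 3) => helmholtzProfile k ‖v‖) (w - y) :=
  fderiv_comp_sub (f := fun v : EuclideanSpace ℝ (Fin 3) => helmholtzProfile k ‖v‖) y

lemma fderiv_Gk_right (k : ℝ) (w y : EuclideanSpace ℝ (Fin 3)) :
    fderiv ℝ (fun v => Gk k w v) y = -fderiv ℝ (fun v => Gk k v y) w := by
  rw [fderiv_Gk_left]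
  have hsymm : (fun v => Gk k w v) = fun v => helmholtzProfile k ‖v - w‖ := by
    funext v
    rw [norm_sub_rev]
    rfl
  have hodd := fderiv_comp_smul (𝕜 := ℝ) (x := y - w)
    (f := fun v : EuclideanSpace ℝ (Fin 3) => helmholtzProfile k ‖v‖) (-1)
  simp only [neg_smul, one_smul, norm_neg, neg_sub] at hodd
  rw [hsymm, fderiv_comp_sub (f := fun v : EuclideanSpace ℝ (Fin 3) => helmholtzProfile k ‖v‖) w,
    hodd]

/-- Mixed second partial derivatives of `G_k`:
(i) `Σ_i ∂²G_k/∂x_i∂y_i = k² G_k(x,y)`, and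
(ii) `∂²G_k/∂x_i∂y_j = −∂²G_k/∂x_i∂x_j` for all `i, j`. -/
theorem mixed_partials_Gk (k : ℝ) (x y : EuclideanSpace ℝ (Fin 3)) (hxy : x ≠ y) :
    ((∑ i : Fin 3,
        fderiv ℝ (fun w => fderiv ℝ (fun v => Gk k w v) y (EuclideanSpace.single i 1)) x
          (EuclideanSpace.single i 1)) = (k : ℂ) ^ 2 * Gk k x y) ∧
    ∀ i j : Fin 3,
      fderiv ℝ (fun w => fderiv ℝ (fun v => Gk k w v) y (EuclideanSpace.single j 1)) x
          (EuclideanSpace.single i 1) =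
        - fderiv ℝ (fun w => fderiv ℝ (fun v => Gk k v y) w (EuclideanSpace.single j 1)) x
            (EuclideanSpace.single i 1) := by
  have mixed : ∀ i j : Fin 3,
      fderiv ℝ (fun w => fderiv ℝ (fun v => Gk k w v) y (EuclideanSpace.single j 1)) x
          (EuclideanSpace.single i 1) =
        - fderiv ℝ (fun w => fderiv ℝ (fun v => Gk k v y) w (EuclideanSpace.single j 1)) x
            (EuclideanSpace.single i 1) := by
    intro i j
    simp only [fderiv_Gk_right, neg_apply]
    rw [fderiv_fun_neg, neg_apply]
  refine ⟨?_, mixed⟩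
  have shift (i : Fin 3) := congrArg (· (EuclideanSpace.single i (1 : ℝ)))
    (fderiv_comp_sub (𝕜 := ℝ) (x := x) (f := fun u => fderiv ℝ
      (fun w : EuclideanSpace ℝ (Fin 3) => helmholtzProfile k ‖w‖) u
      (EuclideanSpace.single i 1)) y)
  simp only [mixed, fderiv_Gk_left, shift, Finset.sum_neg_distrib,
    sum_fderiv_fderiv_helmholtzProfile_norm k (sub_ne_zero.mpr hxy), neg_neg]
  rfl
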